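/- arXiv:2101.02646 — 3 statements merged into one kernel-verified Lean document; each statement's English description precedes it below -/
import Mathlib

section
/- Let T > 0 and let H̃ be a real Hilbert space whose elements are continuously differentiable functions from ℝⁿ to ℝ, equipped with a continuous map Φ : ℝⁿ → H̃ satisfying the reproducing property g(x) = ⟨g, Φ x⟩_{H̃} for all g ∈ H̃ and x ∈ ℝⁿ, and a continuous map Ψ : ℝⁿ × ℝⁿ → H̃ satisfying ⟨g, Ψ(x,v)⟩_{H̃} = ∇g(x)·v for all g ∈ H̃ and x, v ∈ ℝⁿ. Then for every continuously differentiable θ : [0,T] → ℝⁿ and every g ∈ H̃, the function t ↦ g(θ(t)) is continuously differentiable and satisfies ∫₀^T |g(θ(t))|² + |(d/dt) g(θ(t))|² dt ≤ ‖g‖²_{H̃} · ∫₀^T ( ‖Φ(θ(t))‖²_{H̃} + ‖Ψ(θ(t), θ'(t))‖²_{H̃} ) dt, and the right-hand integral is finite. Consequently the composition operator g ↦ g ∘ θ is bounded from H̃ into the Sobolev space H¹(0,T). -/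
open scoped RealInnerProductSpace
open MeasureTheory

/-- For a Hilbert space `H̃` of continuously differentiable functions on `ℝⁿ`
with continuous reproducing maps `Φ` (for point evaluation) and `Ψ` (for directional
derivatives of evaluations), and any `C¹` signal `θ : [0,T] → ℝⁿ`: for every `g ∈ H̃` the
map `t ↦ g(θ(t))` is `C¹`, the `H¹`-type energy of `g ∘ θ` is bounded by
`‖g‖² ∫₀ᵀ (‖Φ(θ(t))‖² + ‖Ψ(θ(t),θ'(t))‖²) dt` with finite right-hand side, and
consequently the composition operator `g ↦ g ∘ θ` is bounded from `H̃` into `H¹(0,T)`. -/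
theorem stmt_2 (n : ℕ) (T : ℝ) (hT : 0 < T)
    (H : Type*) [NormedAddCommGroup H] [InnerProductSpace ℝ H] [CompleteSpace H]
    (evH : H → (Fin n → ℝ) → ℝ)
    (hC1 : ∀ g : H, ContDiff ℝ 1 (evH g))
    (Φ : (Fin n → ℝ) → H) (hΦc : Continuous Φ)
    (hΦ : ∀ (g : H) (x : Fin n → ℝ), evH g x = ⟪g, Φ x⟫)
    (Ψ : (Fin n → ℝ) × (Fin n → ℝ) → H) (hΨc : Continuous Ψ)
    (hΨ : ∀ (g : H) (x v : Fin n → ℝ), ⟪g, Ψ (x, v)⟫ = fderiv ℝ (evH g) x v)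
    (θ : ℝ → (Fin n → ℝ)) (hθ : ContDiffOn ℝ 1 θ (Set.Icc 0 T)) :
    (∀ g : H, ContDiffOn ℝ 1 (fun t => evH g (θ t)) (Set.Icc 0 T)) ∧
    (IntegrableOn
      (fun t => ‖Φ (θ t)‖ ^ 2 + ‖Ψ (θ t, derivWithin θ (Set.Icc 0 T) t)‖ ^ 2)
      (Set.Icc 0 T)) ∧
    (∀ g : H,
      (∫ t in (0 : ℝ)..T,
          (|evH g (θ t)| ^ 2 +
            |derivWithin (fun s => evH g (θ s)) (Set.Icc 0 T) t| ^ 2)) ≤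
        ‖g‖ ^ 2 *
          ∫ t in (0 : ℝ)..T,
            (‖Φ (θ t)‖ ^ 2 + ‖Ψ (θ t, derivWithin θ (Set.Icc 0 T) t)‖ ^ 2)) ∧
    (∃ c : ℝ, 0 ≤ c ∧ ∀ g : H,
      (∫ t in (0 : ℝ)..T,
          (|evH g (θ t)| ^ 2 +
            |derivWithin (fun s => evH g (θ s)) (Set.Icc 0 T) t| ^ 2)) ≤
        c * ‖g‖ ^ 2) := by
  have hu : UniqueDiffOn ℝ (Set.Icc (0 : ℝ) T) := uniqueDiffOn_Icc hT
  have hθc : ContinuousOn θ (Set.Icc 0 T) := hθ.continuousOn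
  have hθd : ContinuousOn (derivWithin θ (Set.Icc 0 T)) (Set.Icc 0 T) :=
    hθ.continuousOn_derivWithin hu le_rfl
  have h1 : ∀ g : H, ContDiffOn ℝ 1 (fun t => evH g (θ t)) (Set.Icc 0 T) :=
    fun g => (hC1 g).comp_contDiffOn hθ
  have hR : ContinuousOn
      (fun t => ‖Φ (θ t)‖ ^ 2 + ‖Ψ (θ t, derivWithin θ (Set.Icc 0 T) t)‖ ^ 2)
      (Set.Icc 0 T) :=
    ((hΦc.comp_continuousOn hθc).norm.pow 2).add
      ((hΨc.comp_continuousOn (hθc.prodMk hθd)).norm.pow 2)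
  have h3 : ∀ g : H,
      (∫ t in (0 : ℝ)..T,
          (|evH g (θ t)| ^ 2 +
            |derivWithin (fun s => evH g (θ s)) (Set.Icc 0 T) t| ^ 2)) ≤
        ‖g‖ ^ 2 *
          ∫ t in (0 : ℝ)..T,
            (‖Φ (θ t)‖ ^ 2 + ‖Ψ (θ t, derivWithin θ (Set.Icc 0 T) t)‖ ^ 2) := by
    intro g
    rw [← intervalIntegral.integral_const_mul]
    refine intervalIntegral.integral_mono_on hT.le ?_ ?_ ?_
    · apply ContinuousOn.intervalIntegrable_of_Icc hT.le
      exact ((h1 g).continuousOn.abs.pow 2).add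
        (((h1 g).continuousOn_derivWithin hu le_rfl).abs.pow 2)
    · exact (continuousOn_const.mul hR).intervalIntegrable_of_Icc hT.le
    · intro t ht
      have hd : derivWithin (fun s => evH g (θ s)) (Set.Icc 0 T) t
          = ⟪g, Ψ (θ t, derivWithin θ (Set.Icc 0 T) t)⟫ := by
        rw [hΨ]
        have ha : HasFDerivAt (evH g) (fderiv ℝ (evH g) (θ t)) (θ t) :=
          ((hC1 g).differentiable one_ne_zero _).hasFDerivAt
        have hb : HasDerivWithinAt θ (derivWithin θ (Set.Icc 0 T) t) (Set.Icc 0 T) t :=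
          (hθ.differentiableOn one_ne_zero t ht).hasDerivWithinAt
        exact (ha.comp_hasDerivWithinAt t hb).derivWithin (hu t ht)
      rw [hd, hΦ, mul_add, ← mul_pow, ← mul_pow]
      gcongr <;> exact abs_real_inner_le_norm _ _
  refine ⟨h1, hR.integrableOn_Icc, h3, _, ?_, fun g => (h3 g).trans_eq (mul_comm _ _)⟩
  exact intervalIntegral.integral_nonneg hT.le (fun t _ => by positivity)
end

section
/- Let T > 0, let H be a real Hilbert space whose elements are continuously differentiable functions from ℝⁿ to ℝ, equipped with a continuous map Φ : ℝⁿ → H satisfying the reproducing property g(x) = ⟨g, Φ x⟩_H for all g ∈ H and x ∈ ℝⁿ. Let f : ℝⁿ → ℝⁿ and let γ : [0,T] → ℝⁿ be continuously differentiable with γ'(t) = f(γ(t)) for all t ∈ [0,T]. Define the first order occupation kernel Γ^{(1)}_γ := ∫₀^T Φ(γ(t)) dt (Bochner integral). Then for every g ∈ H such that the function A_f g : x ↦ ∇g(x)·f(x) also belongs to H, one has ⟨A_f g, Γ^{(1)}_γ⟩_H = ⟨g, Φ(γ(T)) − Φ(γ(0))⟩_H. -/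
open scoped RealInnerProductSpace
open MeasureTheory

/-- For a RKHS `H` of continuously differentiable functions on `ℝⁿ` with
continuous kernel map `Φ`, a trajectory `γ` of `ẋ = f(x)` on `[0,T]`, and the first order
occupation kernel `Γ^{(1)}_γ = ∫₀ᵀ Φ(γ(t)) dt`: for every `g ∈ H` whose Liouville image
`A_f g = ∇g(·)·f(·)` is represented by some `w ∈ H`,
`⟨A_f g, Γ^{(1)}_γ⟩ = ⟨g, Φ(γ(T)) − Φ(γ(0))⟩`. -/
theorem stmt_7 (n : ℕ) (T : ℝ) (hT : 0 < T)
    (H : Type*) [NormedAddCommGroup H] [InnerProductSpace ℝ H] [CompleteSpace H]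
    (evH : H → (Fin n → ℝ) → ℝ)
    (hC1 : ∀ g : H, ContDiff ℝ 1 (evH g))
    (Φ : (Fin n → ℝ) → H) (hΦc : Continuous Φ)
    (hΦ : ∀ (g : H) (x : Fin n → ℝ), evH g x = ⟪g, Φ x⟫)
    (f : (Fin n → ℝ) → (Fin n → ℝ))
    (γ : ℝ → (Fin n → ℝ))
    (hγ : ∀ t ∈ Set.Icc (0 : ℝ) T, HasDerivWithinAt γ (f (γ t)) (Set.Icc 0 T) t)
    (hγ' : ContinuousOn (fun t => f (γ t)) (Set.Icc 0 T))
    (g w : H) (hw : ∀ x : Fin n → ℝ, evH w x = fderiv ℝ (evH g) x (f x)) :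
    ⟪w, ∫ t in (0 : ℝ)..T, Φ (γ t)⟫ = ⟪g, Φ (γ T) - Φ (γ 0)⟫ := by
  have hγc : ContinuousOn γ (Set.Icc 0 T) := fun t ht => (hγ t ht).continuousWithinAt
  have hc : ContinuousOn (fun t => Φ (γ t)) (Set.Icc 0 T) := hΦc.comp_continuousOn hγc
  have hint : IntervalIntegrable (fun t => Φ (γ t)) volume 0 T :=
    hc.intervalIntegrable_of_Icc hT.le
  have h1 : ⟪w, ∫ t in (0 : ℝ)..T, Φ (γ t)⟫ = ∫ t in (0 : ℝ)..T, ⟪w, Φ (γ t)⟫ :=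
    ((innerSL ℝ w).intervalIntegral_comp_comm hint).symm
  have hwc : ContinuousOn (fun t => ⟪w, Φ (γ t)⟫) (Set.Icc 0 T) :=
    (innerSL ℝ w).continuous.comp_continuousOn hc
  have h2 : ∫ t in (0 : ℝ)..T, ⟪w, Φ (γ t)⟫ = evH g (γ T) - evH g (γ 0) := by
    refine intervalIntegral.integral_eq_sub_of_hasDerivAt_of_le hT.le
      (f := fun t => evH g (γ t)) ((hC1 g).continuous.comp_continuousOn hγc) ?_
      (hwc.intervalIntegrable_of_Icc hT.le)
    intro t ht
    have hd := (hγ t (Set.Ioo_subset_Icc_self ht)).hasDerivAt (Icc_mem_nhds ht.1 ht.2)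
    have hf := (((hC1 g).differentiable (by norm_num)) (γ t)).hasFDerivAt
    rw [← hΦ, hw]
    exact hf.comp_hasDerivAt t hd
  rw [h1, h2, inner_sub_right, hΦ, hΦ]
end

section
/- Let T > 0 and let H be a real Hilbert space whose elements are twice continuously differentiable functions from ℝⁿ to ℝ, equipped with a continuous map Φ : ℝⁿ → H satisfying the reproducing property g(x) = ⟨g, Φ x⟩_H for all g ∈ H and x ∈ ℝⁿ, and a map Ψ : ℝⁿ × ℝⁿ → H satisfying ⟨g, Ψ(x,v)⟩_H = ∇g(x)·v for all g ∈ H and x, v ∈ ℝⁿ. Let f : ℝⁿ → ℝⁿ be continuous, let γ : [0,T] → ℝⁿ be twice continuously differentiable with γ''(t) = f(γ(t)) for all t ∈ [0,T], and define the second order occupation kernel Γ^{(2)}_γ := ∫₀^T (T−t) Φ(γ(t)) dt (Bochner integral). If g ∈ H and w ∈ H satisfy w(γ(t)) = (d²/dt²) g(γ(t)) for all t ∈ [0,T], then ⟨w, Γ^{(2)}_γ⟩_H = ⟨g, Φ(γ(T)) − Φ(γ(0)) − T·Ψ(γ(0), γ'(0))⟩_H. -/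
open scoped RealInnerProductSpace
open MeasureTheory

/-- Proposition 1 of the paper: Let `H` be a RKHS of `C²` functions on
`ℝⁿ` with kernel map `Φ` and gradient-representing map `Ψ`, let `γ` be a `C²` trajectory
of `ẍ = f(x)` on `[0,T]` (`f` continuous), and let
`Γ^{(2)}_γ = ∫₀ᵀ (T−t) Φ(γ(t)) dt`. If `g, w ∈ H` satisfy
`w(γ(t)) = (d²/dt²) g(γ(t))` on `[0,T]`, then
`⟨w, Γ^{(2)}_γ⟩ = ⟨g, Φ(γ(T)) − Φ(γ(0)) − T·Ψ(γ(0), γ'(0))⟩`. -/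
theorem stmt_11 (n : ℕ) (T : ℝ) (hT : 0 < T)
    (H : Type*) [NormedAddCommGroup H] [InnerProductSpace ℝ H] [CompleteSpace H]
    (evH : H → (Fin n → ℝ) → ℝ)
    (hC2 : ∀ g : H, ContDiff ℝ 2 (evH g))
    (Φ : (Fin n → ℝ) → H) (hΦc : Continuous Φ)
    (hΦ : ∀ (g : H) (x : Fin n → ℝ), evH g x = ⟪g, Φ x⟫)
    (Ψ : (Fin n → ℝ) × (Fin n → ℝ) → H)
    (hΨ : ∀ (g : H) (x v : Fin n → ℝ), ⟪g, Ψ (x, v)⟫ = fderiv ℝ (evH g) x v)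
    (f : (Fin n → ℝ) → (Fin n → ℝ)) (hf : Continuous f)
    (γ : ℝ → (Fin n → ℝ)) (hγ : ContDiffOn ℝ 2 γ (Set.Icc 0 T))
    (hode : ∀ t ∈ Set.Icc (0 : ℝ) T,
      derivWithin (derivWithin γ (Set.Icc 0 T)) (Set.Icc 0 T) t = f (γ t))
    (g w : H)
    (hw : ∀ t ∈ Set.Icc (0 : ℝ) T,
      evH w (γ t) =
        derivWithin (derivWithin (fun s => evH g (γ s)) (Set.Icc 0 T)) (Set.Icc 0 T) t) :
    ⟪w, ∫ t in (0 : ℝ)..T, (T - t) • Φ (γ t)⟫ =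
      ⟪g, Φ (γ T) - Φ (γ 0) - T • Ψ (γ 0, derivWithin γ (Set.Icc 0 T) 0)⟫ := by
  have hu : UniqueDiffOn ℝ (Set.Icc (0 : ℝ) T) := uniqueDiffOn_Icc hT
  have h0 : (0 : ℝ) ∈ Set.Icc (0 : ℝ) T := ⟨le_rfl, hT.le⟩
  have hh : ContDiffOn ℝ 2 (fun s => evH g (γ s)) (Set.Icc 0 T) :=
    (hC2 g).comp_contDiffOn hγ
  have hh1 : ContDiffOn ℝ 1 (derivWithin (fun s => evH g (γ s)) (Set.Icc 0 T))
      (Set.Icc 0 T) := hh.derivWithin hu (by norm_num)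
  have hd0 : derivWithin (fun s => evH g (γ s)) (Set.Icc 0 T) 0
      = fderiv ℝ (evH g) (γ 0) (derivWithin γ (Set.Icc 0 T) 0) := by
    have a : HasFDerivAt (evH g) (fderiv ℝ (evH g) (γ 0)) (γ 0) :=
      (((hC2 g).differentiable (by norm_num)) (γ 0)).hasFDerivAt
    have b := ((hγ.differentiableOn (by norm_num)) 0 h0).hasDerivWithinAt
    exact (a.comp_hasDerivWithinAt (0 : ℝ) b).derivWithin (hu 0 h0)
  have hcont : ContinuousOn (fun t => (T - t) • Φ (γ t)) (Set.Icc 0 T) :=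
    (continuousOn_const.sub continuousOn_id).smul (hΦc.comp_continuousOn hγ.continuousOn)
  have hint : IntervalIntegrable (fun t => (T - t) • Φ (γ t)) volume 0 T :=
    hcont.intervalIntegrable_of_Icc hT.le
  have e1 : ⟪w, ∫ t in (0 : ℝ)..T, (T - t) • Φ (γ t)⟫
      = ∫ t in (0 : ℝ)..T, (T - t) * evH w (γ t) := by
    have := (innerSL ℝ w).intervalIntegral_comp_comm hint
    simp only [innerSL_apply_apply, inner_smul_right, ← hΦ] at this
    exact this.symm
  have hcw : ContinuousOn (fun t => (T - t) * evH w (γ t)) (Set.Icc 0 T) :=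
    (continuousOn_const.sub continuousOn_id).mul
      ((hC2 w).continuous.comp_continuousOn hγ.continuousOn)
  have e2 := intervalIntegral.integral_eq_sub_of_hasDerivAt_of_le hT.le
    (f := fun t => (T - t) * derivWithin (fun s => evH g (γ s)) (Set.Icc 0 T) t
      + evH g (γ t)) (f' := fun t => (T - t) * evH w (γ t))
    (((continuousOn_const.sub continuousOn_id).mul hh1.continuousOn).add hh.continuousOn)
    (by
      intro t ht
      have ht' := Set.Ioo_subset_Icc_self ht
      have hn : Set.Icc (0 : ℝ) T ∈ nhds t := Icc_mem_nhds ht.1 ht.2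
      have a := (((hh.differentiableOn (by norm_num)) t ht').hasDerivWithinAt).hasDerivAt hn
      have b := (((hh1.differentiableOn (by norm_num)) t ht').hasDerivWithinAt).hasDerivAt hn
      rw [← hw t ht'] at b
      have c := (((hasDerivAt_id t).const_sub T).mul b).add a
      refine c.congr_deriv ?_
      simp)
    (hcw.intervalIntegrable_of_Icc hT.le)
  rw [e1, e2, inner_sub_right, inner_sub_right, inner_smul_right, hΨ, ← hΦ, ← hΦ, hd0]
  ring
end
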